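/- Let x > 0 and let r : (0,∞) → ℝ be continuously differentiable with both r and r' bounded. Then E[(ξ_{x,h} − x)³ r(ξ_{x,h})] = O(h²) as h → 0⁺. -/

import Mathlib

open Real Filter Set MeasureTheory

/-- The Gamma kernel with shape `α` and scale `θ`:
`K_{G(α,θ)}(u) = u^{α−1} e^{−u/θ} / (θ^α Γ(α))`. -/
noncomputable def gammaKernel (α θ u : ℝ) : ℝ :=
  u ^ (α - 1) * Real.exp (-u / θ) / (θ ^ α * Real.Gamma α)

/-- `E[f(ξ_{x,h})] = ∫₀^∞ f(u) K_{G(x/h+1,h)}(u) du`. -/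
noncomputable def Egamma (x h : ℝ) (f : ℝ → ℝ) : ℝ :=
  ∫ u in Set.Ioi (0:ℝ), f u * gammaKernel (x / h + 1) h u

/-- The moments of the Gamma kernel. -/
lemma gk_moment (x h : ℝ) (hx : 0 < x) (hh : 0 < h) (n : ℕ) :
    (∫ u in Set.Ioi (0:ℝ), u ^ n * gammaKernel (x / h + 1) h u)
      = h ^ n * Real.Gamma (x / h + 1 + n) / Real.Gamma (x / h + 1) := by
  have ha : 0 < x / h + 1 := by positivity
  have han : 0 < x / h + 1 + n := by positivity
  have key := Real.integral_rpow_mul_exp_neg_mul_Ioi han (inv_pos.2 hh)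
  have hG := (Real.Gamma_pos_of_pos ha).ne'
  have hp := (Real.rpow_pos_of_pos hh (x / h + 1)).ne'
  have e : ∀ u ∈ Set.Ioi (0:ℝ), u ^ n * gammaKernel (x / h + 1) h u =
      (u ^ (x / h + 1 + n - 1) * Real.exp (-(h⁻¹ * u))) *
        (h ^ (x / h + 1) * Real.Gamma (x / h + 1))⁻¹ := by
    intro u hu
    have hu' : (0:ℝ) < u := hu
    have e1 : x / h + 1 + n - 1 = (x / h + 1 - 1) + n := by ring
    have e2 : -(h⁻¹ * u) = -u / h := by ring
    rw [gammaKernel, e1, Real.rpow_add_natCast hu'.ne', e2]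
    ring
  rw [setIntegral_congr_fun measurableSet_Ioi e, integral_mul_const, key]
  rw [one_div, inv_inv, Real.rpow_add_natCast hh.ne']
  field_simp

lemma gk_integrable (x h : ℝ) (hx : 0 < x) (hh : 0 < h) (n : ℕ) :
    IntegrableOn (fun u => u ^ n * gammaKernel (x / h + 1) h u) (Set.Ioi (0:ℝ)) := by
  have ha : 0 < x / h + 1 := by positivity
  have han : 0 < x / h + 1 + n := by positivity
  by_contra hc
  have h0 := integral_undef hc
  rw [gk_moment x h hx hh n] at h0
  have h1 := Real.Gamma_pos_of_pos ha
  have h2 := Real.Gamma_pos_of_pos han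
  have : 0 < h ^ n * Real.Gamma (x / h + 1 + n) / Real.Gamma (x / h + 1) := by positivity
  linarith

lemma gk_moment_zero (x h : ℝ) (hx : 0 < x) (hh : 0 < h) :
    (∫ u in Set.Ioi (0:ℝ), u ^ 0 * gammaKernel (x / h + 1) h u) = 1 := by
  have ha : 0 < x / h + 1 := by positivity
  rw [gk_moment x h hx hh 0]
  have h1 := (Real.Gamma_pos_of_pos ha).ne'
  simp [h1]

lemma gk_moment_succ (x h : ℝ) (hx : 0 < x) (hh : 0 < h) (n : ℕ) :
    (∫ u in Set.Ioi (0:ℝ), u ^ (n + 1) * gammaKernel (x / h + 1) h u) =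
      (x + (n + 1) * h) * ∫ u in Set.Ioi (0:ℝ), u ^ n * gammaKernel (x / h + 1) h u := by
  have han : 0 < x / h + 1 + n := by positivity
  rw [gk_moment x h hx hh, gk_moment x h hx hh]
  have e : x / h + 1 + ((n + 1 : ℕ) : ℝ) = (x / h + 1 + n) + 1 := by push_cast; ring
  have e2 : x + (n + 1) * h = h * (x / h + 1 + n) := by field_simp; ring
  rw [e, Real.Gamma_add_one han.ne', e2]
  ring

lemma gk_central3 (x h : ℝ) (hx : 0 < x) (hh : 0 < h) :
    IntegrableOn (fun u => (u - x) ^ 3 * gammaKernel (x / h + 1) h u) (Set.Ioi (0:ℝ)) ∧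
    (∫ u in Set.Ioi (0:ℝ), (u - x) ^ 3 * gammaKernel (x / h + 1) h u) =
      5 * h ^ 2 * x + 6 * h ^ 3 := by
  have i := gk_integrable x h hx hh
  have s := gk_moment_succ x h hx hh
  have m0 := gk_moment_zero x h hx hh
  have m1 := s 0
  have m2 := s 1
  have m3 := s 2
  norm_num only at m1 m2 m3
  rw [m0] at m1
  rw [m1] at m2
  rw [m2] at m3
  have e : (fun u => (u - x) ^ 3 * gammaKernel (x / h + 1) h u) = fun u =>
      (u ^ 3 * gammaKernel (x / h + 1) h u + (-3 * x) * (u ^ 2 * gammaKernel (x / h + 1) h u))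
      + ((3 * x ^ 2) * (u ^ 1 * gammaKernel (x / h + 1) h u)
      + (-x ^ 3) * (u ^ 0 * gammaKernel (x / h + 1) h u)) := by
    funext u; ring
  have j1 := ((i 2).const_mul (-3 * x))
  have j2 := ((i 1).const_mul (3 * x ^ 2))
  have j3 := ((i 0).const_mul (-x ^ 3))
  rw [e]
  refine ⟨((i 3).add j1).add (j2.add j3), ?_⟩
  rw [integral_add (Integrable.fun_add (i 3) j1) (Integrable.fun_add j2 j3), integral_add (i 3) j1, integral_add j2 j3,
    integral_const_mul, integral_const_mul, integral_const_mul, m0, m1, m2, m3]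
  push_cast
  ring

lemma gk_central4 (x h : ℝ) (hx : 0 < x) (hh : 0 < h) :
    IntegrableOn (fun u => (u - x) ^ 4 * gammaKernel (x / h + 1) h u) (Set.Ioi (0:ℝ)) ∧
    (∫ u in Set.Ioi (0:ℝ), (u - x) ^ 4 * gammaKernel (x / h + 1) h u) =
      3 * x ^ 2 * h ^ 2 + 26 * x * h ^ 3 + 24 * h ^ 4 := by
  have i := gk_integrable x h hx hh
  have s := gk_moment_succ x h hx hh
  have m0 := gk_moment_zero x h hx hh
  have m1 := s 0
  have m2 := s 1
  have m3 := s 2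
  have m4 := s 3
  norm_num only at m1 m2 m3 m4
  rw [m0] at m1
  rw [m1] at m2
  rw [m2] at m3
  rw [m3] at m4
  have c3 := gk_central3 x h hx hh
  have e : (fun u => (u - x) ^ 4 * gammaKernel (x / h + 1) h u) = fun u =>
      ((u ^ 4 * gammaKernel (x / h + 1) h u + (-3 * x) * (u ^ 3 * gammaKernel (x / h + 1) h u))
      + ((3 * x ^ 2) * (u ^ 2 * gammaKernel (x / h + 1) h u)
      + (-x ^ 3) * (u ^ 1 * gammaKernel (x / h + 1) h u)))
      + (-x) * ((u - x) ^ 3 * gammaKernel (x / h + 1) h u) := by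
    funext u; ring
  have j1 := ((i 3).const_mul (-3 * x))
  have j2 := ((i 2).const_mul (3 * x ^ 2))
  have j3 := ((i 1).const_mul (-x ^ 3))
  have j4 := c3.1.const_mul (-x)
  rw [e]
  refine ⟨(((i 4).add j1).add (j2.add j3)).add j4, ?_⟩
  rw [integral_add (Integrable.fun_add (Integrable.fun_add (i 4) j1) (Integrable.fun_add j2 j3)) j4,
    integral_add (Integrable.fun_add (i 4) j1) (Integrable.fun_add j2 j3), integral_add (i 4) j1, integral_add j2 j3,
    integral_const_mul, integral_const_mul, integral_const_mul, integral_const_mul,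
    m1, m2, m3, m4, c3.2]
  push_cast
  ring

lemma gk_nonneg (x h : ℝ) (hx : 0 < x) (hh : 0 < h) (u : ℝ) (hu : 0 < u) :
    0 ≤ gammaKernel (x / h + 1) h u := by
  have ha : 0 < x / h + 1 := by positivity
  have := Real.Gamma_pos_of_pos ha
  unfold gammaKernel
  positivity

lemma gk_measurable (a h : ℝ) : Measurable (gammaKernel a h) := by
  unfold gammaKernel
  fun_prop

/-- For `x > 0` and `r` continuously differentiable on `(0,∞)` with `r` and `r'` bounded
there, `E[(ξ_{x,h} − x)³ r(ξ_{x,h})] = O(h²)` as `h → 0⁺`. -/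
theorem beta3_order (x : ℝ) (hx : 0 < x) (r : ℝ → ℝ)
    (hr : ContDiffOn ℝ 1 r (Set.Ioi 0))
    (hrb : ∃ C, ∀ u ∈ Set.Ioi (0:ℝ), |r u| ≤ C)
    (hrb' : ∃ C, ∀ u ∈ Set.Ioi (0:ℝ), |derivWithin r (Set.Ioi 0) u| ≤ C) :
    ∃ C > 0, ∃ h₀ > 0, ∀ h : ℝ, 0 < h → h < h₀ →
      |Egamma x h (fun u => (u - x) ^ 3 * r u)| ≤ C * h ^ 2 := by
  obtain ⟨B, hB⟩ := hrb'
  have hB0 : 0 ≤ B := (abs_nonneg _).trans (hB x hx)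
  have hlip : ∀ u ∈ Set.Ioi (0:ℝ), |r u - r x| ≤ B * |u - x| := by
    intro u hu
    exact (convex_Ioi (0:ℝ)).norm_image_sub_le_of_norm_derivWithin_le
      (hr.differentiableOn (by norm_num)) hB hx hu
  refine ⟨|r x| * (5 * x + 6) + B * (3 * x ^ 2 + 26 * x + 24) + 1, by positivity, 1, one_pos, ?_⟩
  intro h hh h1
  obtain ⟨i3, c3⟩ := gk_central3 x h hx hh
  obtain ⟨i4, c4⟩ := gk_central4 x h hx hh
  have hdom : ∀ u ∈ Set.Ioi (0:ℝ), ‖(u - x) ^ 3 * (r u - r x) * gammaKernel (x / h + 1) h u‖ ≤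
      B * ((u - x) ^ 4 * gammaKernel (x / h + 1) h u) := by
    intro u hu
    have hk := gk_nonneg x h hx hh u hu
    rw [Real.norm_eq_abs, abs_mul, abs_mul, abs_pow, abs_of_nonneg hk]
    have e4 : (u - x) ^ 4 = |u - x| ^ 3 * |u - x| := by
      rw [← pow_succ, (show Even (3 + 1) by decide).pow_abs]
    rw [e4]
    calc |u - x| ^ 3 * |r u - r x| * gammaKernel (x / h + 1) h u
        ≤ |u - x| ^ 3 * (B * |u - x|) * gammaKernel (x / h + 1) h u := by
          gcongr; exact hlip u hu
      _ = _ := by ring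
  have hae : ∀ᵐ u ∂(volume.restrict (Set.Ioi (0:ℝ))),
      ‖(u - x) ^ 3 * (r u - r x) * gammaKernel (x / h + 1) h u‖ ≤
      B * ((u - x) ^ 4 * gammaKernel (x / h + 1) h u) :=
    (ae_restrict_iff' measurableSet_Ioi).2 (ae_of_all _ hdom)
  have hrm : AEStronglyMeasurable r (volume.restrict (Set.Ioi (0:ℝ))) :=
    hr.continuousOn.aestronglyMeasurable measurableSet_Ioi
  have hm : AEStronglyMeasurable
      (fun u => (u - x) ^ 3 * (r u - r x) * gammaKernel (x / h + 1) h u)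
      (volume.restrict (Set.Ioi (0:ℝ))) := by
    refine AEStronglyMeasurable.mul (AEStronglyMeasurable.mul ?_ ?_) ?_
    · exact (by fun_prop : Continuous fun u : ℝ => (u - x) ^ 3).aestronglyMeasurable
    · exact hrm.sub aestronglyMeasurable_const
    · exact (gk_measurable _ _).aestronglyMeasurable
  have ig := Integrable.mono' (i4.const_mul B) hm hae
  have hbound := norm_integral_le_of_norm_le (i4.const_mul B) hae
  rw [integral_const_mul, c4, Real.norm_eq_abs] at hbound
  have hE : Egamma x h (fun u => (u - x) ^ 3 * r u) =
      (∫ u in Set.Ioi (0:ℝ), (u - x) ^ 3 * (r u - r x) * gammaKernel (x / h + 1) h u)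
      + r x * (5 * h ^ 2 * x + 6 * h ^ 3) := by
    rw [← c3, ← integral_const_mul, ← integral_add ig (i3.const_mul (r x)), Egamma]
    congr 1
    funext u
    ring
  rw [hE]
  refine (abs_add_le _ _).trans ?_
  have hp3 : h ^ 3 ≤ h ^ 2 := pow_le_pow_of_le_one hh.le h1.le (by norm_num)
  have hp4 : h ^ 4 ≤ h ^ 2 := pow_le_pow_of_le_one hh.le h1.le (by norm_num)
  have q1 : |r x * (5 * h ^ 2 * x + 6 * h ^ 3)| ≤ |r x| * (5 * h ^ 2 * x + 6 * h ^ 2) := by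
    rw [abs_mul, abs_of_nonneg (by positivity : 0 ≤ 5 * h ^ 2 * x + 6 * h ^ 3)]
    gcongr
  have q2 : B * (3 * x ^ 2 * h ^ 2 + 26 * x * h ^ 3 + 24 * h ^ 4) ≤
      B * (3 * x ^ 2 * h ^ 2 + 26 * x * h ^ 2 + 24 * h ^ 2) := by
    gcongr
  nlinarith [sq_nonneg h]
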